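/- arXiv:math/0406412 — 2 statements merged into one kernel-verified Lean document; each statement's English description precedes it below -/
import Mathlib

section
/- Let k be an algebraically closed field. Let A₁ and A₂ be affine domains over k with trdeg_k(A₁) = trdeg_k(A₂) = 1. Let B be an integral domain that is a k-algebra with AK(B) = k. If A₁ ⊗_k B and A₂ ⊗_k B are isomorphic as k-algebras, then A₁ and A₂ are isomorphic as k-algebras. -/
open Polynomial TensorProduct

/-- An *exponential map* on a commutative `k`-algebra `A` is a `k`-algebra homomorphism
`φ : A → A[t]` such that evaluation at `t = 0` composed with `φ` is the identity, and
applying `φ` coefficientwise to `φ a` equals substituting `s + t` for `t` in `φ a`. -/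
def IsExponential {k A : Type*} [CommRing k] [CommRing A] [Algebra k A]
    (φ : A →ₐ[k] A[X]) : Prop :=
  (∀ a : A, (φ a).eval 0 = a) ∧
  (∀ a : A, (φ a).map (φ : A →+* A[X]) =
      (φ a).eval₂ ((C : A[X] →+* A[X][X]).comp (C : A →+* A[X])) (X + C X))

/-- The ring of `φ`-invariants `A^φ = {a : A | φ a = C a}`. -/
noncomputable def expInvariants {k A : Type*} [CommRing k] [CommRing A] [Algebra k A]
    (φ : A →ₐ[k] A[X]) : Subalgebra k A :=
  AlgHom.equalizer φ ((Algebra.ofId A A[X]).restrictScalars k)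

/-- The AK invariant (ring of absolute constants) of a commutative `k`-algebra `A`:
the intersection of `A^φ` over all exponential maps `φ` on `A`. -/
noncomputable def AK (k A : Type*) [CommRing k] [CommRing A] [Algebra k A] : Subalgebra k A :=
  ⨅ φ : {ψ : A →ₐ[k] A[X] // IsExponential ψ}, expInvariants φ.1

/-- `A` has transcendence degree 1 over `k`: some single element is a transcendence basis. -/
def TrdegOne (k A : Type*) [CommRing k] [CommRing A] [Algebra k A] : Prop :=
  ∃ x : A, IsTranscendenceBasis k (fun _ : Unit => x)

lemma exists_algHom_ne_zero {k R : Type*} [Field k] [IsAlgClosed k] [CommRing R] [IsDomain R]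
    [Algebra k R] [Algebra.FiniteType k R] {c : R} (hc : c ≠ 0) :
    ∃ χ : R →ₐ[k] k, χ c ≠ 0 := by
  have : IsJacobsonRing R := isJacobsonRing_of_finiteType (A := k)
  have hj : (⊥ : Ideal R).jacobson = ⊥ := ‹IsJacobsonRing R›.out Ideal.isRadical_bot
  have : ∃ M : Ideal R, M.IsMaximal ∧ c ∉ M := by
    by_contra! h
    apply hc
    rw [← Ideal.mem_bot, ← hj, Ideal.jacobson, Ideal.mem_sInf]
    exact fun {M} hM => h M hM.2
  obtain ⟨M, hM, hcM⟩ := this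
  let := Ideal.Quotient.field M
  have : Module.Finite k (R ⧸ M) := finite_of_finite_type_of_isJacobsonRing k (R ⧸ M)
  let e := AlgEquiv.ofBijective (Algebra.ofId k (R ⧸ M))
    (IsAlgClosed.algebraMap_bijective_of_isIntegral)
  refine ⟨e.symm.toAlgHom.comp (Ideal.Quotient.mkₐ k M), ?_⟩
  simpa [Ideal.Quotient.eq_zero_iff_mem] using hcM

lemma isDomain_tensorProduct {k A B : Type*} [Field k] [IsAlgClosed k] [CommRing A] [IsDomain A]
    [Algebra k A] [Algebra.FiniteType k A] [CommRing B] [IsDomain B] [Algebra k B] :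
    IsDomain (A ⊗[k] B) := by
  let b := Module.Free.chooseBasis k B
  let bA := Algebra.TensorProduct.basis A b
  have key : ∀ (χ : A →ₐ[k] k) (z : A ⊗[k] B) (i),
      b.repr (Algebra.TensorProduct.lift ((Algebra.ofId k B).comp χ) (AlgHom.id k B)
        (fun _ _ => Commute.all _ _) z) i = χ (bA.repr z i) := by
    intro χ z i
    induction z with
    | zero => simp
    | add x y hx hy => simp [hx, hy]
    | tmul x y =>
      simp [bA, Algebra.ofId_apply, ← Algebra.smul_def]
  have : NoZeroDivisors (A ⊗[k] B) := ⟨by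
    intro z w hzw
    by_contra! h
    obtain ⟨i, hi⟩ : ∃ i, bA.repr z i ≠ 0 := by
      by_contra! h'
      exact h.1 (bA.repr.map_eq_zero_iff.1 (Finsupp.ext h'))
    obtain ⟨j, hj⟩ : ∃ i, bA.repr w i ≠ 0 := by
      by_contra! h'
      exact h.2 (bA.repr.map_eq_zero_iff.1 (Finsupp.ext h'))
    obtain ⟨χ, hχ⟩ := exists_algHom_ne_zero (k := k) (mul_ne_zero hi hj)
    rw [map_mul, ← key, ← key] at hχ
    have h0 := congrArg (Algebra.TensorProduct.lift ((Algebra.ofId k B).comp χ) (AlgHom.id k B)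
        (fun _ _ => Commute.all _ _)) hzw
    rw [map_mul, map_zero] at h0
    rcases mul_eq_zero.1 h0 with h0 | h0 <;> simp [h0] at hχ⟩
  have : Nontrivial (A ⊗[k] B) :=
    (Algebra.TensorProduct.includeLeft_injective (S := k) (A := A) (B := B)
      (algebraMap k B).injective).nontrivial
  exact NoZeroDivisors.to_isDomain _

section Exponential

variable {k A : Type*} [CommRing k] [CommRing A] [Algebra k A] {φ : A →ₐ[k] A[X]}

lemma mem_expInvariants_iff {a : A} : a ∈ expInvariants φ ↔ φ a = C a := by
  simp [expInvariants, AlgHom.mem_equalizer, Algebra.ofId_apply]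

lemma mem_AK_iff {a : A} :
    a ∈ AK k A ↔ ∀ φ : A →ₐ[k] A[X], IsExponential φ → φ a = C a := by
  simp [AK, Algebra.mem_iInf, mem_expInvariants_iff]

lemma IsExponential.injective (hφ : IsExponential φ) : Function.Injective φ := by
  intro a b h
  rw [← hφ.1 a, h, hφ.1]

lemma IsExponential.map_eq_taylor (hφ : IsExponential φ) (a : A) :
    (φ a).map (φ : A →+* A[X]) = taylor X ((φ a).map C) := by
  rw [hφ.2, taylor_apply, comp, eval₂_map]

lemma IsExponential.map_leadingCoeff (hφ : IsExponential φ) (a : A) :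
    φ (φ a).leadingCoeff = C (φ a).leadingCoeff := by
  have h := congrArg (fun p => p.coeff (φ a).natDegree) (hφ.map_eq_taylor a)
  have h2 : ((φ a).map (C : A →+* A[X])).natDegree = (φ a).natDegree :=
    natDegree_map_eq_of_injective C_injective _
  have h3 : (taylor (X : A[X]) ((φ a).map C)).coeff (φ a).natDegree =
      ((φ a).map (C : A →+* A[X])).coeff (φ a).natDegree := by
    rw [← h2, coeff_taylor_natDegree, leadingCoeff]
  simpa [h3] using h

lemma IsExponential.eval_neg_X_map (hφ : IsExponential φ) (a : A) :
    ((φ a).map (φ : A →+* A[X])).eval (-X) = C a := by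
  rw [hφ.map_eq_taylor, taylor_eval, neg_add_cancel, eval_map, eval₂_at_zero,
    coeff_zero_eq_eval_zero, hφ.1]

lemma IsExponential.natDegree_pos (hφ : IsExponential φ) {a : A} (ha : φ a ≠ C a) :
    0 < (φ a).natDegree := by
  rw [Nat.pos_iff_ne_zero]
  intro h
  apply ha
  rw [eq_C_of_natDegree_eq_zero h, coeff_zero_eq_eval_zero, hφ.1]

lemma IsExponential.exists_invariant_mul_eq [IsDomain A] (hφ : IsExponential φ) {n d c : A}
    (hc : c ≠ 0) {G : A[X]} (h : C c * φ n = G * φ d) :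
    ∃ s r : A, s ≠ 0 ∧ φ s = C s ∧ s * n = r * d := by
  have h1 := congrArg (fun p => (p.map (φ : A →+* A[X])).eval (-X)) h
  simp only [Polynomial.map_mul, eval_mul, hφ.eval_neg_X_map, map_C, eval_C] at h1
  have h2 := congrArg (fun p => p.coeff (φ c).natDegree) h1
  refine ⟨(φ c).leadingCoeff, _, ?_, hφ.map_leadingCoeff c, by simpa using h2⟩
  rw [leadingCoeff_ne_zero]
  exact (map_ne_zero_iff _ hφ.injective).2 hc

lemma IsExponential.eq_C_of_aeval_eq_zero [IsDomain A] (hφ : IsExponential φ) {S : Subalgebra k A}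
    (hS : ∀ s ∈ S, φ s = C s) {a : A} {p : S[X]} (hp : p ≠ 0) (h : aeval a p = 0) :
    φ a = C a := by
  by_contra ha
  have hdeg := hφ.natDegree_pos ha
  have h1 : (p.map (algebraMap S A)).comp (φ a) = 0 := by
    rw [comp, eval₂_map]
    have h2 := congrArg φ h
    rw [aeval_def, map_zero, ← AlgHom.coe_toRingHom, hom_eval₂] at h2
    rw [← h2]
    congr 1
    ext1 s
    exact (hS s s.2).symm
  have h3 : p.map (algebraMap S A) ≠ 0 :=
    (Polynomial.map_ne_zero_iff Subtype.val_injective).2 hp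
  rcases comp_eq_zero_iff.1 h1 with h | h
  · exact h3 h
  · rw [h.2] at hdeg
    simp at hdeg

end Exponential

section TensorExponential

variable {k A B : Type*} [Field k] [CommRing A] [Algebra k A] [CommRing B] [Algebra k B]

/-- The extension of `φ : B → B[X]` to `A ⊗ B` that fixes `A`. -/
noncomputable def tensorExponential (A : Type*) [CommRing A] [Algebra k A] (φ : B →ₐ[k] B[X]) :
    A ⊗[k] B →ₐ[k] (A ⊗[k] B)[X] :=
  Algebra.TensorProduct.lift
    ((CAlgHom (R := k) (A := A ⊗[k] B)).comp Algebra.TensorProduct.includeLeft)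
    ((mapAlgHom Algebra.TensorProduct.includeRight).comp φ) (fun _ _ => Commute.all _ _)

lemma tensorExponential_tmul (φ : B →ₐ[k] B[X]) (a : A) (b : B) :
    tensorExponential A φ (a ⊗ₜ b) = C (a ⊗ₜ 1) *
      (φ b).map ((Algebra.TensorProduct.includeRight : B →ₐ[k] A ⊗[k] B) : B →+* A ⊗[k] B) := by
  simp [tensorExponential]

lemma isExponential_tensorExponential {φ : B →ₐ[k] B[X]} (hφ : IsExponential φ) :
    IsExponential (tensorExponential A φ) := by
  constructor
  · intro z
    induction z with
    | zero => simp
    | add x y hx hy => simp [hx, hy]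
    | tmul a b =>
      rw [tensorExponential_tmul, eval_mul, eval_C, eval_zero_map, hφ.1]
      simp
  · intro z
    induction z with
    | zero => simp
    | add x y hx hy => simp [hx, hy, eval₂_add]
    | tmul a b =>
      rw [tensorExponential_tmul, Polynomial.map_mul, eval₂_mul, map_C, eval₂_C, Polynomial.map_map,
        eval₂_map]
      congr 1
      · simp [tensorExponential_tmul]
      · have h := congrArg (mapRingHom (mapRingHom
          ((Algebra.TensorProduct.includeRight : B →ₐ[k] A ⊗[k] B) : B →+* A ⊗[k] B))) (hφ.2 b)
        rw [hom_eval₂, coe_mapRingHom, Polynomial.map_map] at h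
        simp only [coe_mapRingHom, Polynomial.map_add, map_X, map_C] at h
        convert h using 1
        · congr 1
          ext1 x
          simp [tensorExponential_tmul, ← Algebra.TensorProduct.one_def]
        · congr 1
          ext1 x
          simp

lemma mem_range_includeLeft_of_fixed (hB : AK k B = ⊥) {z : A ⊗[k] B}
    (hz : ∀ φ : B →ₐ[k] B[X], IsExponential φ → tensorExponential A φ z = C z) :
    ∃ a : A, z = a ⊗ₜ 1 := by
  classical
  let b := Module.Free.chooseBasis k A
  let bB := (Algebra.TensorProduct.basis B b)
  let e := Algebra.TensorProduct.comm k A B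
  have key : ∀ (φ : B →ₐ[k] B[X]) (w : A ⊗[k] B) (i) (n),
      bB.repr (e ((tensorExponential A φ w).coeff n)) i = (φ (bB.repr (e w) i)).coeff n := by
    intro φ w i n
    induction w with
    | zero => simp
    | add x y hx hy => simp [hx, hy]
    | tmul x y => simp [tensorExponential_tmul, bB, e, coeff_C_mul]
  have hmem : ∀ i, bB.repr (e z) i ∈ AK k B := by
    intro i
    rw [mem_AK_iff]
    intro φ hφ
    ext n
    rw [← key, hz φ hφ, coeff_C, coeff_C]
    split_ifs <;> simp
  rw [hB] at hmem
  choose c hc using fun i => Algebra.mem_bot.1 (hmem i)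
  refine ⟨∑ i ∈ (bB.repr (e z)).support, c i • b i, ?_⟩
  apply e.injective
  conv_lhs => rw [← bB.linearCombination_repr (e z), Finsupp.linearCombination_apply, Finsupp.sum]
  simp only [e, Algebra.TensorProduct.comm_tmul, TensorProduct.tmul_sum]
  refine Finset.sum_congr rfl fun i _ => ?_
  rw [← hc]
  simp [bB, TensorProduct.smul_tmul', Algebra.algebraMap_eq_smul_one]

end TensorExponential

section Transport

variable {k C₁ C₂ : Type*} [CommRing k] [CommRing C₁] [Algebra k C₁] [CommRing C₂] [Algebra k C₂]

/-- Transport of a homomorphism `C₁ → C₁[X]` along an isomorphism `C₁ ≃ C₂`. -/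
noncomputable def transportExponential (σ : C₁ ≃ₐ[k] C₂) (φ : C₁ →ₐ[k] C₁[X]) : C₂ →ₐ[k] C₂[X] :=
  ((mapAlgHom (σ : C₁ →ₐ[k] C₂)).comp φ).comp (σ.symm : C₂ →ₐ[k] C₁)

lemma transportExponential_apply (σ : C₁ ≃ₐ[k] C₂) (φ : C₁ →ₐ[k] C₁[X]) (c : C₁) :
    transportExponential σ φ (σ c) = (φ c).map (σ : C₁ →+* C₂) := by
  simp [transportExponential]

lemma isExponential_transportExponential (σ : C₁ ≃ₐ[k] C₂) {φ : C₁ →ₐ[k] C₁[X]}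
    (hφ : IsExponential φ) : IsExponential (transportExponential σ φ) := by
  constructor
  · intro c
    obtain ⟨c, rfl⟩ := σ.surjective c
    rw [transportExponential_apply, eval_zero_map, hφ.1]
    simp
  · intro c
    obtain ⟨c, rfl⟩ := σ.surjective c
    rw [transportExponential_apply, Polynomial.map_map, eval₂_map]
    have h := congrArg (mapRingHom (mapRingHom (σ : C₁ →+* C₂))) (hφ.2 c)
    rw [hom_eval₂, coe_mapRingHom, Polynomial.map_map] at h
    simp only [coe_mapRingHom, Polynomial.map_add, map_X, map_C] at h
    convert h using 1
    · congr 1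
      ext1 x
      exact transportExponential_apply σ φ x
    · congr 1
      ext1 x
      simp

end Transport

lemma exists_polynomial_mul_eq_of_isIntegral {A C : Type*} [CommRing A] [IsDomain A]
    [CommRing C] [IsDomain C] (f : A →+* C[X]) (hf : Function.Injective f) {n d : A}
    {y : FractionRing A} (hy : IsIntegral A y)
    (hyd : y * algebraMap A (FractionRing A) d = algebraMap A (FractionRing A) n) :
    ∃ (c : C) (G : C[X]), c ≠ 0 ∧ Polynomial.C c * f n = G * f d := by
  let K := FractionRing C
  let L := FractionRing K[X]
  let g : A →+* K[X] := (mapRingHom (algebraMap C K)).comp f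
  have hCK : Function.Injective (algebraMap C K) := IsFractionRing.injective C K
  have hg : Function.Injective g := (map_injective _ hCK).comp hf
  have hgL : Function.Injective ((algebraMap K[X] L).comp g) :=
    (IsFractionRing.injective K[X] L).comp hg
  let F : FractionRing A →+* L := IsFractionRing.lift hgL
  have hF : ∀ a, F (algebraMap A _ a) = algebraMap K[X] L (g a) := fun a =>
    IsFractionRing.lift_algebraMap hgL a
  have hyInt : IsIntegral K[X] (F y) :=
    hy.map_of_comp_eq g F (RingHom.ext fun a => (hF a).symm)
  obtain ⟨w, hw⟩ := IsIntegrallyClosed.isIntegral_iff.1 hyInt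
  have hwd : w * g d = g n := by
    apply IsFractionRing.injective K[X] L
    rw [map_mul, hw, ← hF, ← hF, ← map_mul, hyd]
  obtain ⟨c, hcm, hc⟩ := IsLocalization.integerNormalization_spec (nonZeroDivisors C) w
  refine ⟨c, IsLocalization.integerNormalization (nonZeroDivisors C) w,
    nonZeroDivisors.ne_zero hcm, ?_⟩
  apply map_injective _ hCK
  rw [Polynomial.map_mul, Polynomial.map_mul, hc, map_C]
  change _ * g n = _ * g d
  rw [← hwd, smul_mul_assoc, ← mul_assoc, mul_assoc, ← algebraMap_smul K, smul_eq_C_mul]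

lemma mem_map_includeLeft_of_mul_eq {k A B : Type*} [Field k] [CommRing A] [Algebra k A]
    [CommRing B] [Algebra k B] {I : Ideal A} {n d : A} {s r : A ⊗[k] B}
    (hI : ∀ x y : A, x * n = y * d → x ∈ I) (h : s * (n ⊗ₜ 1) = r * (d ⊗ₜ 1)) :
    s ∈ I.map (Algebra.TensorProduct.includeLeft : A →ₐ[k] A ⊗[k] B) := by
  let bA := Algebra.TensorProduct.basis A (Module.Free.chooseBasis k B)
  have hsm : ∀ (z : A ⊗[k] B) (a : A), z * (a ⊗ₜ 1) = a • z := by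
    intro z a
    rw [Algebra.smul_def, mul_comm]
    rfl
  rw [hsm, hsm] at h
  have hmem : ∀ i, bA.repr s i ∈ I := by
    intro i
    apply hI _ (bA.repr r i)
    have := DFunLike.congr_fun (congrArg bA.repr h) i
    simpa [mul_comm] using this
  rw [← bA.linearCombination_repr s, Finsupp.linearCombination_apply]
  refine Ideal.sum_mem _ fun i _ => ?_
  change bA.repr s i • bA i ∈ _
  rw [Algebra.smul_def]
  exact Ideal.mul_mem_right _ _ (Ideal.mem_map_of_mem _ (hmem i))

lemma isIntegrallyClosed_of_exponential {k A B : Type*} [Field k] [CommRing A] [IsDomain A]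
    [Algebra k A] [CommRing B] [Algebra k B] [IsDomain (A ⊗[k] B)] [Nontrivial B]
    {φ : A ⊗[k] B →ₐ[k] (A ⊗[k] B)[X]} (hφ : IsExponential φ)
    (h : ∀ m : Ideal A, m.IsMaximal → ∀ q, φ q = C q →
      q ∈ m.map (Algebra.TensorProduct.includeLeft : A →ₐ[k] A ⊗[k] B) → q = 0) :
    IsIntegrallyClosed A := by
  rw [isIntegrallyClosed_iff (FractionRing A)]
  intro y hy
  obtain ⟨n, d, hd, rfl⟩ := IsFractionRing.div_surjective (A := A) y
  have hd0 := nonZeroDivisors.ne_zero hd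
  have hd1 : algebraMap A (FractionRing A) d ≠ 0 := by simpa using hd0
  have hinj : Function.Injective (Algebra.TensorProduct.includeLeft : A →ₐ[k] A ⊗[k] B) :=
    Algebra.TensorProduct.includeLeft_injective (algebraMap k B).injective
  obtain ⟨c, G, hc, hG⟩ := exists_polynomial_mul_eq_of_isIntegral
    (φ.comp (Algebra.TensorProduct.includeLeft : A →ₐ[k] A ⊗[k] B)).toRingHom
    (hφ.injective.comp hinj) hy (div_mul_cancel₀ _ hd1)
  obtain ⟨s, r, hs0, hs, hsr⟩ := hφ.exists_invariant_mul_eq hc hG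
  let I : Ideal A := Submodule.comap (LinearMap.mulRight A n) (Ideal.span {d})
  have hI : ∀ x, x ∈ I ↔ d ∣ x * n := fun x => by
    simp [I, Ideal.mem_span_singleton]
  by_cases htop : I = ⊤
  · have : (1 : A) ∈ I := htop ▸ Submodule.mem_top
    rw [hI, one_mul] at this
    obtain ⟨z, rfl⟩ := this
    exact ⟨z, by rw [map_mul, mul_div_cancel_left₀ _ hd1]⟩
  · obtain ⟨m, hm, hIm⟩ := I.exists_le_maximal htop
    refine (hs0 (h m hm s hs (Ideal.map_mono hIm (mem_map_includeLeft_of_mul_eq ?_ hsr)))).elim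
    exact fun x y hxy => (hI x).2 ⟨y, by rw [hxy, mul_comm]⟩

lemma exists_specialization {k A C : Type*} [Field k] [IsAlgClosed k] [CommRing A] [Algebra k A]
    [Algebra.FiniteType k A] [CommRing C] [IsDomain C] [Algebra k C] (f : A →ₐ[k] C[X])
    (T : Finset C[X]) {c₁ c₂ : C} (h₁ : c₁ ≠ 0) (h₂ : c₂ ≠ 0) :
    ∃ (D : Subalgebra k C[X]) (Χ : D →ₐ[k] k[X]), f.range ≤ D ∧ (T : Set C[X]) ⊆ D ∧
      (∀ p : D, (Χ p).natDegree ≤ p.1.natDegree) ∧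
      ∀ (p : D) (i : ℕ), p.1.coeff i = c₁ ∨ p.1.coeff i = c₂ → (Χ p).coeff i ≠ 0 := by
  classical
  obtain ⟨S, hS⟩ := Algebra.FiniteType.out (R := k) (A := A)
  let U : Finset C := {c₁, c₂} ∪ (T ∪ S.image f).biUnion Polynomial.coeffs
  let R : Subalgebra k C := Algebra.adjoin k U
  have : Algebra.FiniteType k R := R.fg_iff_finiteType.1 ⟨U, rfl⟩
  have hU : ∀ u ∈ U, u ∈ R := fun u hu => Algebra.subset_adjoin hu
  have hc₁ : c₁ ∈ R := hU _ (by simp [U])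
  have hc₂ : c₂ ∈ R := hU _ (by simp [U])
  obtain ⟨χ, hχ⟩ := exists_algHom_ne_zero (k := k) (R := R) (c := ⟨c₁, hc₁⟩ * ⟨c₂, hc₂⟩)
    (mul_ne_zero (by simpa [Subtype.ext_iff] using h₁) (by simpa [Subtype.ext_iff] using h₂))
  rw [map_mul, mul_ne_zero_iff] at hχ
  let j : R[X] →ₐ[k] C[X] := mapAlgHom R.val
  have hj : Function.Injective j := map_injective _ Subtype.val_injective
  let e := AlgEquiv.ofInjective j hj
  have hmem : ∀ p : C[X], (∀ i, p.coeff i ∈ R) → p ∈ j.range := by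
    intro p hp
    have : p ∈ lifts (R.val : R →+* C) := by
      rw [lifts_iff_coeff_lifts]
      exact fun n => ⟨⟨_, hp n⟩, rfl⟩
    obtain ⟨q, hq⟩ := (mem_lifts _).1 this
    exact ⟨q, hq⟩
  have hmemU : ∀ p ∈ T ∪ S.image f, p ∈ j.range := by
    intro p hp
    apply hmem
    intro i
    by_cases h0 : p.coeff i = 0
    · rw [h0]; exact R.zero_mem
    · apply hU
      apply Finset.mem_union_right
      exact Finset.mem_biUnion.2 ⟨p, hp, coeff_mem_coeffs h0⟩
  have hΧ : ∀ (p : j.range) (i : ℕ), ∃ r : R, r.1 = p.1.coeff i ∧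
      (((mapAlgHom χ).comp e.symm.toAlgHom) p).coeff i = χ r := by
    intro p i
    obtain ⟨q, rfl⟩ := e.surjective p
    exact ⟨q.coeff i, by simp [e, j], by simp⟩
  refine ⟨j.range, (mapAlgHom χ).comp e.symm.toAlgHom, ?_, ?_, ?_, ?_⟩
  · rw [← Algebra.map_top, ← hS, AlgHom.map_adjoin, Algebra.adjoin_le_iff]
    rintro _ ⟨s, hs, rfl⟩
    exact hmemU _ (Finset.mem_union_right _ (Finset.mem_image_of_mem _ hs))
  · exact fun p hp => hmemU p (Finset.mem_union_left _ hp)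
  · intro p
    rw [natDegree_le_iff_coeff_eq_zero]
    intro i hi
    obtain ⟨r, hr, h⟩ := hΧ p i
    rw [h]
    rw [coeff_eq_zero_of_natDegree_lt hi] at hr
    rw [show r = 0 from Subtype.ext hr, map_zero]
  · intro p i hi
    obtain ⟨r, hr, h⟩ := hΧ p i
    rw [h]
    rcases hi with hi | hi
    · rw [show r = ⟨c₁, hc₁⟩ from Subtype.ext (hr.trans hi)]
      exact hχ.1
    · rw [show r = ⟨c₂, hc₂⟩ from Subtype.ext (hr.trans hi)]
      exact hχ.2

lemma isAlgebraic_adjoin_of_transcendental {k A : Type*} [Field k] [CommRing A] [IsDomain A]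
    [Algebra k A] (htr : TrdegOne k A) {a : A} (ha : Transcendental k a) :
    Algebra.IsAlgebraic (Algebra.adjoin k {a}) A := by
  obtain ⟨x, hx⟩ := htr
  have h1 : Algebra.trdeg k A = 1 := by simpa using hx.lift_cardinalMk_eq_trdeg.symm
  have hai : AlgebraicIndependent k (fun _ : Unit => a) :=
    algebraicIndependent_unique_type_iff.2 ha
  have hb := hai.isTranscendenceBasis_of_lift_trdeg_le_of_finite (by simp [h1])
  have := hb.isAlgebraic
  rwa [Set.range_const] at this

lemma isIntegral_of_natDegree_pos {k A : Type*} [Field k] [CommRing A] [Algebra k A]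
    (θ : A →ₐ[k] k[X]) {a : A} (ha : 0 < (θ a).natDegree) : θ.toRingHom.IsIntegral := by
  have hne : θ a ≠ 0 := fun h => by simp [h] at ha
  have hcomp : θ.toRingHom.comp (algebraMap k A) = (C : k →+* k[X]) :=
    RingHom.ext fun c => θ.commutes c
  have hX : θ.toRingHom.IsIntegralElem X := by
    refine ⟨(C ((θ a).leadingCoeff⁻¹) * θ a).map (algebraMap k A) -
      C (algebraMap k A (θ a).leadingCoeff⁻¹ * a), ?_, ?_⟩
    · have hm : (C ((θ a).leadingCoeff⁻¹) * θ a).Monic :=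
        monic_C_mul_of_mul_leadingCoeff_eq_one (inv_mul_cancel₀ (leadingCoeff_ne_zero.2 hne))
      rcases subsingleton_or_nontrivial A with hA | hA
      · exact Subsingleton.elim _ _
      apply (hm.map (algebraMap k A)).sub_of_left
      rw [hm.degree_map]
      refine degree_C_le.trans_lt ?_
      rw [degree_C_mul (inv_ne_zero (leadingCoeff_ne_zero.2 hne))]
      exact natDegree_pos_iff_degree_pos.1 ha
    · rw [eval₂_sub, eval₂_map, hcomp, eval₂_C, map_mul,
        ← RingHom.comp_apply, hcomp, eval₂_C_X, sub_eq_zero]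
      rfl
  intro p
  induction p using Polynomial.induction_on' with
  | add p q hp hq => exact hp.add _ hq
  | monomial n c =>
    rw [← C_mul_X_pow_eq_monomial, ← hcomp, RingHom.comp_apply]
    have h : ∀ n : ℕ, θ.toRingHom.IsIntegralElem (X ^ n : k[X]) := by
      intro n
      induction n with
      | zero => simpa using θ.toRingHom.isIntegralElem_one
      | succ n ih => rw [pow_succ]; exact ih.mul _ hX
    exact (RingHom.isIntegralElem_map _).mul _ (h n)

lemma injective_of_natDegree_pos {k A : Type*} [Field k] [CommRing A] [IsDomain A]
    [Algebra k A] (htr : TrdegOne k A) (θ : A →ₐ[k] k[X]) {a : A} (ha : 0 < (θ a).natDegree) :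
    Function.Injective θ := by
  have hT : Transcendental k (θ a) := (θ a).transcendental ha.ne'
    (mem_nonZeroDivisors_of_ne_zero (leadingCoeff_ne_zero.2 fun h => by simp [h] at ha))
  have hTa : Transcendental k a := fun h => hT (h.algHom θ)
  have := isAlgebraic_adjoin_of_transcendental htr hTa
  change Function.Injective (θ : A →+* k[X])
  rw [RingHom.injective_iff_ker_eq_bot]
  by_contra hker
  obtain ⟨x, hx, hx0⟩ := Submodule.exists_mem_ne_zero_of_ne_bot hker
  apply Ideal.comap_ne_bot_of_algebraic_mem hx0 hx (Algebra.IsAlgebraic.isAlgebraic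
    (R := Algebra.adjoin k {a}) x)
  rw [eq_bot_iff]
  rintro ⟨y, hy⟩ hyk
  obtain ⟨P, rfl⟩ := Algebra.adjoin_singleton_eq_range_aeval k a ▸ hy
  have hP : aeval (θ a) P = 0 := by
    rw [aeval_algHom_apply]
    exact hyk
  have : P = 0 := transcendental_iff.1 hT P hP
  subst this
  exact Subtype.ext (map_zero (aeval a))

lemma eq_zero_of_mem_map_includeLeft {k A B : Type*} [Field k] [IsAlgClosed k]
    [CommRing A] [IsDomain A] [Algebra k A] [Algebra.FiniteType k A]
    [CommRing B] [Algebra k B] [IsDomain (A ⊗[k] B)] (htr : TrdegOne k A)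
    {φ : A ⊗[k] B →ₐ[k] (A ⊗[k] B)[X]} {a₀ : A}
    (ha₀ : 0 < (φ (a₀ ⊗ₜ 1)).natDegree)
    {m : Ideal A} (hm : m.IsMaximal) {q : A ⊗[k] B} (hq : φ q = C q)
    (hqm : q ∈ m.map (Algebra.TensorProduct.includeLeft : A →ₐ[k] A ⊗[k] B)) : q = 0 := by
  classical
  by_contra hq0
  obtain ⟨n, c, hc⟩ : ∃ (s : Finset m) (b : m → A ⊗[k] B),
      q = ∑ i ∈ s, b i * (i.1 ⊗ₜ 1) := by
    rw [Ideal.map, Set.image_eq_range, Ideal.span,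
      Finsupp.mem_span_range_iff_exists_finsupp] at hqm
    obtain ⟨c, rfl⟩ := hqm
    exact ⟨c.support, c, rfl⟩
  have hl : (φ (a₀ ⊗ₜ 1)).leadingCoeff ≠ 0 :=
    leadingCoeff_ne_zero.2 fun h => by simp [h] at ha₀
  obtain ⟨D, Χ, hf, hT, hdeg, hΧ⟩ := exists_specialization
    (φ.comp (Algebra.TensorProduct.includeLeft : A →ₐ[k] A ⊗[k] B))
    (insert (C q) (n.image fun i => φ (c i))) hl hq0
  have hfD : ∀ a : A, φ (a ⊗ₜ 1) ∈ D := fun a => hf ⟨a, rfl⟩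
  let θ : A →ₐ[k] k[X] := Χ.comp ((φ.comp Algebra.TensorProduct.includeLeft).codRestrict D hfD)
  have hθ : 0 < (θ a₀).natDegree :=
    ha₀.trans_le (le_natDegree_of_ne_zero (hΧ ⟨_, hfD a₀⟩ _ (Or.inl rfl)))
  have hCq : C q ∈ D := hT (by simp)
  have hu : IsUnit (Χ ⟨C q, hCq⟩) := by
    have h1 : (Χ ⟨C q, hCq⟩).natDegree ≤ 0 := by simpa using hdeg ⟨C q, hCq⟩
    rw [eq_C_of_natDegree_le_zero h1, isUnit_C]
    exact (hΧ ⟨C q, hCq⟩ 0 (Or.inr (by simp))).isUnit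
  have hmem : Χ ⟨C q, hCq⟩ ∈ m.map (θ : A →+* k[X]) := by
    have hcD : ∀ i ∈ n, φ (c i) ∈ D := fun i hi =>
      hT (Finset.mem_coe.2 (Finset.mem_insert_of_mem (Finset.mem_image_of_mem _ hi)))
    have : (⟨C q, hCq⟩ : D) = ∑ i ∈ n.attach, ⟨φ (c i.1), hcD _ i.2⟩ * ⟨_, hfD i.1.1⟩ := by
      apply Subtype.ext
      rw [AddSubmonoidClass.coe_finsetSum]
      change C q = ∑ i ∈ n.attach, φ (c i.1) * φ (i.1.1 ⊗ₜ 1)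
      rw [n.sum_attach (fun i => φ (c i) * φ (i.1 ⊗ₜ 1)), ← hq, hc, map_sum]
      simp
    rw [this, map_sum]
    refine sum_mem fun i _ => ?_
    rw [map_mul]
    exact Ideal.mul_mem_left _ _ (Ideal.mem_map_of_mem (θ : A →+* k[X]) i.1.2)
  have htop := Ideal.eq_top_of_isUnit_mem _ hmem hu
  rw [Ideal.map_eq_top_iff (θ : A →+* k[X]) (injective_of_natDegree_pos htr θ hθ)
    (isIntegral_of_natDegree_pos θ hθ)] at htop
  exact hm.ne_top htop

lemma isIntegrallyClosed_of_exponential_ne {k A B : Type*} [Field k] [IsAlgClosed k]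
    [CommRing A] [IsDomain A] [Algebra k A] [Algebra.FiniteType k A]
    [CommRing B] [IsDomain B] [Algebra k B] (htr : TrdegOne k A)
    {φ : A ⊗[k] B →ₐ[k] (A ⊗[k] B)[X]} (hφ : IsExponential φ) {a₀ : A}
    (ha₀ : φ (a₀ ⊗ₜ 1) ≠ C (a₀ ⊗ₜ 1)) :
    IsIntegrallyClosed A ∧ ∃ θ : A →ₐ[k] k[X], 0 < (θ a₀).natDegree := by
  have := isDomain_tensorProduct (k := k) (A := A) (B := B)
  have hpos := hφ.natDegree_pos ha₀
  refine ⟨isIntegrallyClosed_of_exponential hφ fun m hm q hq hqm =>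
    eq_zero_of_mem_map_includeLeft htr hpos hm hq hqm, ?_⟩
  have hl : (φ (a₀ ⊗ₜ 1)).leadingCoeff ≠ 0 :=
    leadingCoeff_ne_zero.2 fun h => by simp [h] at hpos
  obtain ⟨D, Χ, hf, -, -, hΧ⟩ := exists_specialization
    (φ.comp (Algebra.TensorProduct.includeLeft : A →ₐ[k] A ⊗[k] B)) ∅ hl hl
  have hfD : ∀ a : A, φ (a ⊗ₜ 1) ∈ D := fun a => hf ⟨a, rfl⟩
  exact ⟨Χ.comp ((φ.comp Algebra.TensorProduct.includeLeft).codRestrict D hfD),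
    hpos.trans_le (le_natDegree_of_ne_zero (hΧ ⟨_, hfD a₀⟩ _ (Or.inl rfl)))⟩

open IntermediateField in
lemma exists_isCoprime_of_mem_adjoin_simple {k L : Type*} [Field k] [Field L] [Algebra k L]
    {g x : L} (hx : x ∈ k⟮g⟯) :
    ∃ P Q : k[X], IsCoprime P Q ∧ aeval g Q ≠ 0 ∧ x * aeval g Q = aeval g P := by
  classical
  obtain ⟨r, s, rfl⟩ := (mem_adjoin_simple_iff k x).1 hx
  by_cases hs : aeval g s = 0
  · exact ⟨0, 1, isCoprime_zero_left.2 isUnit_one, by simp, by simp [hs]⟩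
  have hs0 : s ≠ 0 := fun h => hs (by simp [h])
  have h := isCoprime_div_gcd_div_gcd (p := r) (q := s) hs0
  obtain ⟨r', hr⟩ := gcd_dvd_left r s
  obtain ⟨s', hs'⟩ := gcd_dvd_right r s
  have hd : gcd r s ≠ 0 := fun h => hs0 (by rw [hs', h, zero_mul])
  rw [show r / gcd r s = r' from (EuclideanDomain.eq_div_of_mul_eq_right hd hr.symm).symm,
    show s / gcd r s = s' from (EuclideanDomain.eq_div_of_mul_eq_right hd hs'.symm).symm] at h
  generalize gcd r s = d at *
  subst hr hs'
  rw [map_mul, ← ne_eq, mul_ne_zero_iff] at hs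
  refine ⟨r', s', h, hs.2, ?_⟩
  rw [map_mul, map_mul]
  rw [mul_div_mul_left _ _ hs.1, div_mul_cancel₀ _ hs.2]

lemma isIntegral_inv_of_mem_adjoin {R L : Type*} [CommRing R] [Field L] [Algebra R L] {w : L}
    (h : w⁻¹ ∈ Algebra.adjoin R {w}) : IsIntegral R w⁻¹ := by
  nontriviality R
  by_cases hw : w = 0
  · simpa [hw] using isIntegral_zero
  obtain ⟨p, hp⟩ := Algebra.adjoin_singleton_eq_range_aeval R w ▸ h
  replace hp : aeval w p = w⁻¹ := hp
  refine ⟨X ^ (p.natDegree + 1) - p.reverse, ?_, ?_⟩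
  · apply monic_X_pow_sub
    exact degree_le_natDegree.trans_lt (by
      exact_mod_cast (Nat.lt_succ_of_le (reverse_natDegree_le p)))
  · have : Invertible w := invertibleOfNonzero hw
    have h := eval₂_reverse_mul_pow (algebraMap R L) w p
    rw [invOf_eq_inv, ← aeval_def, ← aeval_def, hp] at h
    rw [← aeval_def, map_sub, map_pow, aeval_X, sub_eq_zero]
    generalize aeval w⁻¹ p.reverse = z at h
    calc w⁻¹ ^ (p.natDegree + 1) = w⁻¹ ^ p.natDegree * (z * w ^ p.natDegree) := by rw [h, pow_succ]
      _ = z := by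
        rw [mul_left_comm, ← mul_pow, inv_mul_cancel₀ hw, one_pow, mul_one]

open IntermediateField in
lemma exists_polynomial_adjoin_simple_eq {k : Type*} [Field k] [IsAlgClosed k] {g : RatFunc k}
    {f : k[X]} (hf : 0 < f.natDegree) (hfg : algebraMap k[X] (RatFunc k) f ∈ k⟮g⟯) :
    ∃ p : k[X], k⟮g⟯ = k⟮algebraMap k[X] (RatFunc k) p⟯ := by
  obtain ⟨P, Q, hPQ, hQ, h⟩ := exists_isCoprime_of_mem_adjoin_simple hfg
  have hQ0 : Q ≠ 0 := fun h => hQ (by simp [h])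
  by_cases hdeg : Q.degree = 0
  · obtain ⟨c, rfl⟩ : ∃ c, Q = C c := ⟨_, eq_C_of_degree_eq_zero hdeg⟩
    have hc : c ≠ 0 := fun h => hQ0 (by simp [h])
    have hP : 0 < P.natDegree := by
      by_contra hP
      rw [eq_C_of_natDegree_eq_zero (Nat.eq_zero_of_not_pos hP), aeval_C, aeval_C,
        IsScalarTower.algebraMap_apply k k[X] (RatFunc k),
        IsScalarTower.algebraMap_apply k k[X] (RatFunc k), ← map_mul] at h
      have := RatFunc.algebraMap_injective k h
      rw [algebraMap_eq] at this
      have h2 := congrArg natDegree this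
      rw [natDegree_mul_C hc, natDegree_C] at h2
      omega
    have hP0 : P ≠ 0 := fun h => by simp [h] at hP
    have hm : (P * C P.leadingCoeff⁻¹).Monic := monic_mul_leadingCoeff_inv hP0
    have hyInt : IsIntegral k[X] g := by
      apply IsIntegral.of_aeval_monic (hm.map (algebraMap k k[X]))
      · rw [natDegree_map, natDegree_mul_C (inv_ne_zero (leadingCoeff_ne_zero.2 hP0))]
        exact hP.ne'
      · rw [aeval_map_algebraMap, map_mul, ← h, aeval_C, aeval_C,
          IsScalarTower.algebraMap_apply k k[X] (RatFunc k),
          IsScalarTower.algebraMap_apply k k[X] (RatFunc k), ← map_mul, ← map_mul]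
        exact isIntegral_algebraMap
    obtain ⟨p, rfl⟩ := IsIntegrallyClosed.isIntegral_iff.1 hyInt
    exact ⟨p, rfl⟩
  · obtain ⟨β, hβ⟩ := IsAlgClosed.exists_root Q hdeg
    obtain ⟨Q₁, rfl⟩ := dvd_iff_isRoot.2 hβ
    have hPβ : P.eval β ≠ 0 := by
      intro h0
      obtain ⟨u, v, huv⟩ := hPQ
      simpa [h0] using congrArg (eval β) huv
    obtain ⟨P₁, hP₁⟩ := X_sub_C_dvd_sub_C_eval (a := β) (p := P)
    rw [sub_eq_iff_eq_add] at hP₁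
    have key : (g - algebraMap k _ β) * (algebraMap k[X] (RatFunc k) f * aeval g Q₁ - aeval g P₁) =
        algebraMap k _ (P.eval β) := by
      have := congrArg (aeval g) hP₁
      rw [← h] at this
      simp only [map_mul, map_sub, map_add, aeval_X, aeval_C] at this
      linear_combination this
    have hw0 : algebraMap k (RatFunc k) (P.eval β) ≠ 0 := by simpa using hPβ
    have hw : g - algebraMap k _ β ≠ 0 := left_ne_zero_of_mul (key ▸ hw0)
    have hyInt : IsIntegral k[X] (g - algebraMap k _ β)⁻¹ := by
      apply isIntegral_inv_of_mem_adjoin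
      have hgm : ∀ S : k[X], aeval g S ∈ Algebra.adjoin k[X] {g - algebraMap k (RatFunc k) β} := by
        have hg : g ∈ Algebra.adjoin k[X] {g - algebraMap k (RatFunc k) β} := by
          have := add_mem (Algebra.subset_adjoin (R := k[X])
            (Set.mem_singleton (g - algebraMap k (RatFunc k) β)))
            (Subalgebra.algebraMap_mem _ (C β))
          rwa [← algebraMap_eq, ← IsScalarTower.algebraMap_apply, sub_add_cancel] at this
        intro S
        rw [← aeval_map_algebraMap k[X]]
        exact Algebra.adjoin_le (Set.singleton_subset_iff.2 hg) (aeval_mem_adjoin_singleton k[X] g)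
      have : (g - algebraMap k (RatFunc k) β)⁻¹ = algebraMap k[X] (RatFunc k) (C (P.eval β)⁻¹) *
          (algebraMap k[X] (RatFunc k) f * aeval g Q₁ - aeval g P₁) := by
        rw [← algebraMap_eq, ← IsScalarTower.algebraMap_apply, map_inv₀]
        field_simp
        rw [← key, mul_comm]
      rw [this]
      exact mul_mem (Subalgebra.algebraMap_mem _ _) (sub_mem (mul_mem
        (Subalgebra.algebraMap_mem _ _) (hgm _)) (hgm _))
    obtain ⟨p, hp⟩ := IsIntegrallyClosed.isIntegral_iff.1 hyInt
    refine ⟨p, ?_⟩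
    rw [hp]
    apply le_antisymm <;> rw [adjoin_simple_le_iff]
    · have := add_mem (inv_mem (mem_adjoin_simple_self k (g - algebraMap k (RatFunc k) β)⁻¹))
        (IntermediateField.algebraMap_mem k⟮(g - algebraMap k (RatFunc k) β)⁻¹⟯ β)
      rwa [inv_inv, sub_add_cancel] at this
    · exact inv_mem (sub_mem (mem_adjoin_simple_self k g) (IntermediateField.algebraMap_mem _ β))

open IntermediateField in
lemma nonempty_algEquiv_polynomial {k A : Type*} [Field k] [IsAlgClosed k] [CommRing A]
    [IsDomain A] [Algebra k A] [IsIntegrallyClosed A] (θ : A →ₐ[k] k[X])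
    (hinj : Function.Injective θ) {a₀ : A} (ha₀ : 0 < (θ a₀).natDegree) :
    Nonempty (k[X] ≃ₐ[k] A) := by
  let ι : k[X] →ₐ[k] RatFunc k := IsScalarTower.toAlgHom k k[X] (RatFunc k)
  have hι : Function.Injective ι := RatFunc.algebraMap_injective k
  let j : A →ₐ[k] RatFunc k := ι.comp θ
  have hj : Function.Injective j := hι.comp hinj
  let E : IntermediateField k (RatFunc k) := IntermediateField.adjoin k (Set.range j)
  have hjE : ∀ a, j a ∈ E := fun a => subset_adjoin k (Set.range j) ⟨a, rfl⟩
  have hEmem (x : RatFunc k) : x ∈ E → ∃ r s, x = j r / j s := by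
    rw [mem_adjoin_iff_div, show Set.range j = (j.range : Set (RatFunc k)) from rfl,
      Algebra.adjoin_eq]
    rintro ⟨_, ⟨r, rfl⟩, _, ⟨s, rfl⟩, rfl⟩
    exact ⟨r, s, rfl⟩
  have hE : E = k⟮RatFunc.Luroth.generator E⟯ := RatFunc.Luroth.eq_adjoin_generator
  obtain ⟨p, hp⟩ := exists_polynomial_adjoin_simple_eq ha₀ (hE.le (hjE a₀))
  replace hp : E = k⟮ι p⟯ := hE.trans hp
  obtain ⟨u, hu⟩ : ∃ u, θ u = p := by
    obtain ⟨r, s, hrs⟩ := hEmem (ι p) (hp.ge (mem_adjoin_simple_self k (ι p)))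
    let : Algebra A (RatFunc k) := j.toRingHom.toAlgebra
    have : FaithfulSMul A (RatFunc k) := (faithfulSMul_iff_algebraMap_injective _ _).2 hj
    let : Algebra (FractionRing A) (RatFunc k) := FractionRing.liftAlgebra A (RatFunc k)
    have hyInt : IsIntegral A (ι p) := by
      obtain ⟨P, hP, h⟩ := isIntegral_of_natDegree_pos θ ha₀ p
      refine ⟨P, hP, ?_⟩
      have h2 := congrArg ι h
      rw [map_zero] at h2
      rw [← h2]
      exact (hom_eval₂ P θ.toRingHom ι.toRingHom p).symm
    have : ι p = algebraMap (FractionRing A) (RatFunc k)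
        (algebraMap A _ r / algebraMap A _ s) := by
      rw [map_div₀, ← IsScalarTower.algebraMap_apply, ← IsScalarTower.algebraMap_apply]
      exact hrs
    rw [this, isIntegral_algebraMap_iff (algebraMap (FractionRing A) (RatFunc k)).injective,
      IsIntegrallyClosed.isIntegral_iff] at hyInt
    obtain ⟨y, hy⟩ := hyInt
    refine ⟨y, hι ?_⟩
    rw [this, ← hy, ← IsScalarTower.algebraMap_apply]
    rfl
  have hsurj : ∀ a, ∃ P : k[X], θ a = aeval p P := by
    intro a
    obtain ⟨P, Q, ⟨v, w, hvw⟩, -, h⟩ := exists_isCoprime_of_mem_adjoin_simple (hp.le (hjE a))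
    have h1 : θ a * aeval p Q = aeval p P := by
      apply hι
      rw [map_mul, ← aeval_algHom_apply, ← aeval_algHom_apply]
      exact h
    have h2 := congrArg (aeval p) hvw
    rw [map_add, map_mul, map_mul, map_one, ← h1] at h2
    have hu : IsUnit (aeval p Q) :=
      IsUnit.of_mul_eq_one (aeval p v * θ a + aeval p w) (by linear_combination h2)
    obtain ⟨c, hc, hcQ⟩ := isUnit_iff.1 hu
    refine ⟨C c⁻¹ * P, ?_⟩
    rw [map_mul, ← h1, ← hcQ, aeval_C, algebraMap_eq, mul_left_comm, ← C_mul,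
      inv_mul_cancel₀ hc.ne_zero, C_1, mul_one]
  have hpdeg : p.natDegree ≠ 0 := by
    obtain ⟨P, hP⟩ := hsurj a₀
    intro h
    rw [hP, ← comp_eq_aeval, natDegree_comp, h, mul_zero] at ha₀
    exact lt_irrefl 0 ha₀
  have hT : Transcendental k p := p.transcendental hpdeg
    (mem_nonZeroDivisors_of_ne_zero (leadingCoeff_ne_zero.2 fun h => hpdeg (by simp [h])))
  subst hu
  refine ⟨AlgEquiv.ofBijective (aeval u) ⟨?_, fun a => ?_⟩⟩
  · rw [← transcendental_iff_injective]
    exact fun h => hT (h.algHom θ)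
  · obtain ⟨P, hP⟩ := hsurj a
    exact ⟨P, hinj (by rw [hP, aeval_algHom_apply])⟩

lemma nonempty_algEquiv_polynomial_of_exponential_ne {k A B : Type*} [Field k] [IsAlgClosed k]
    [CommRing A] [IsDomain A] [Algebra k A] [Algebra.FiniteType k A]
    [CommRing B] [IsDomain B] [Algebra k B] (htr : TrdegOne k A)
    {φ : A ⊗[k] B →ₐ[k] (A ⊗[k] B)[X]} (hφ : IsExponential φ) {a₀ : A}
    (ha₀ : φ (a₀ ⊗ₜ 1) ≠ C (a₀ ⊗ₜ 1)) : Nonempty (k[X] ≃ₐ[k] A) := by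
  obtain ⟨_, θ, hθ⟩ := isIntegrallyClosed_of_exponential_ne htr hφ ha₀
  exact nonempty_algEquiv_polynomial θ (injective_of_natDegree_pos htr θ hθ) hθ

lemma transportExponential_symm_eq_C {k C₁ C₂ : Type*} [CommRing k] [CommRing C₁] [Algebra k C₁]
    [CommRing C₂] [Algebra k C₂] (σ : C₁ ≃ₐ[k] C₂) {φ : C₂ →ₐ[k] C₂[X]} {c : C₁}
    (h : transportExponential σ.symm φ c = C c) : φ (σ c) = C (σ c) := by
  have h1 := transportExponential_apply σ.symm φ (σ c)
  rw [σ.symm_apply_apply, h] at h1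
  apply map_injective (σ.symm : C₂ →+* C₁) σ.symm.injective
  rw [← h1, map_C]
  simp

/-- Every exponential map on `A ⊗ B` fixes `A ⊗ 1`. -/
def FixesLeft (k A B : Type*) [CommRing k] [CommRing A] [Algebra k A] [CommRing B]
    [Algebra k B] : Prop :=
  ∀ φ : A ⊗[k] B →ₐ[k] (A ⊗[k] B)[X], IsExponential φ → ∀ a : A, φ (a ⊗ₜ 1) = C (a ⊗ₜ 1)

section FixesLeft

variable {k A₁ A₂ B : Type*} [Field k] [CommRing A₁] [Algebra k A₁] [CommRing A₂] [Algebra k A₂]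
  [CommRing B] [Algebra k B]

lemma FixesLeft.exists_algHom [Nontrivial B] (h₁ : FixesLeft k A₁ B) (hB : AK k B = ⊥)
    (σ : A₁ ⊗[k] B ≃ₐ[k] A₂ ⊗[k] B) :
    ∃ f : A₁ →ₐ[k] A₂, ∀ a, σ (a ⊗ₜ 1) = f a ⊗ₜ 1 := by
  have hinj : Function.Injective (Algebra.TensorProduct.includeLeft : A₂ →ₐ[k] A₂ ⊗[k] B) :=
    Algebra.TensorProduct.includeLeft_injective (algebraMap k B).injective
  have h : ∀ a : A₁, ∃ a' : A₂, σ (a ⊗ₜ 1) = a' ⊗ₜ 1 := fun a =>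
    mem_range_includeLeft_of_fixed hB fun φ hφ => transportExponential_symm_eq_C σ
      (h₁ _ (isExponential_transportExponential σ.symm (isExponential_tensorExponential hφ)) a)
  let g : A₁ →ₐ[k] A₂ ⊗[k] B := (σ : A₁ ⊗[k] B →ₐ[k] A₂ ⊗[k] B).comp
    Algebra.TensorProduct.includeLeft
  let e := AlgEquiv.ofInjective _ hinj
  refine ⟨e.symm.toAlgHom.comp (g.codRestrict _ fun a => ?_), fun a => ?_⟩
  · obtain ⟨a', ha'⟩ := h a
    exact ⟨a', ha'.symm⟩
  · obtain ⟨a', ha'⟩ := h a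
    have : (g.codRestrict (Algebra.TensorProduct.includeLeft : A₂ →ₐ[k] A₂ ⊗[k] B).range
        (fun a => (h a).imp fun _ => Eq.symm)) a = e a' := Subtype.ext ha'
    rw [AlgHom.comp_apply, this, ha']
    simp

lemma FixesLeft.congr [IsAlgClosed k] [IsDomain A₁] [IsDomain A₂] [Algebra.FiniteType k A₂]
    [IsDomain B] (h₁ : FixesLeft k A₁ B) (hB : AK k B = ⊥) (σ : A₁ ⊗[k] B ≃ₐ[k] A₂ ⊗[k] B)
    (htr₁ : TrdegOne k A₁) (htr₂ : TrdegOne k A₂) : FixesLeft k A₂ B := by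
  obtain ⟨f, hf⟩ := h₁.exists_algHom hB σ
  obtain ⟨x, hx⟩ := htr₁
  have hinj₁ : Function.Injective (Algebra.TensorProduct.includeLeft : A₁ →ₐ[k] A₁ ⊗[k] B) :=
    Algebra.TensorProduct.includeLeft_injective (algebraMap k B).injective
  have hinj₂ : Function.Injective (Algebra.TensorProduct.includeLeft : A₂ →ₐ[k] A₂ ⊗[k] B) :=
    Algebra.TensorProduct.includeLeft_injective (algebraMap k B).injective
  have hfinj : Function.Injective f := fun a b hab =>
    hinj₁ (σ.injective (by simp [hf, hab]))
  have hfx : Transcendental k (f x) := by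
    have : Transcendental k x := algebraicIndependent_unique_type_iff.1 hx.1
    exact fun h => this ((isAlgebraic_algHom_iff f hfinj).1 h)
  have := isAlgebraic_adjoin_of_transcendental htr₂ hfx
  have := isDomain_tensorProduct (k := k) (A := A₂) (B := B)
  intro φ hφ a
  have hfix : ∀ y ∈ Algebra.adjoin k {f x}, y ⊗ₜ (1 : B) ∈ expInvariants φ := by
    intro y hy
    change y ∈ (expInvariants φ).comap (Algebra.TensorProduct.includeLeft : A₂ →ₐ[k] A₂ ⊗[k] B)
    refine Algebra.adjoin_le (Set.singleton_subset_iff.2 ?_) hy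
    change f x ⊗ₜ (1 : B) ∈ expInvariants φ
    rw [mem_expInvariants_iff, ← hf]
    exact transportExponential_symm_eq_C σ
      (h₁ _ (isExponential_transportExponential σ.symm hφ) x)
  let i : Algebra.adjoin k {f x} →ₐ[k] expInvariants φ :=
    ((Algebra.TensorProduct.includeLeft : A₂ →ₐ[k] A₂ ⊗[k] B).comp
      (Algebra.adjoin k {f x}).val).codRestrict _ fun y => hfix y.1 y.2
  have hi : Function.Injective i := fun y z hyz =>
    Subtype.ext (hinj₂ (congrArg Subtype.val hyz))
  obtain ⟨p, hp0, hp⟩ := Algebra.IsAlgebraic.isAlgebraic (R := Algebra.adjoin k {f x}) a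
  refine hφ.eq_C_of_aeval_eq_zero (S := expInvariants φ) (p := p.map (i : _ →+* expInvariants φ))
    (fun s hs => mem_expInvariants_iff.1 hs) ((Polynomial.map_ne_zero_iff hi).2 hp0) ?_
  have h := congrArg (Algebra.TensorProduct.includeLeft : A₂ →ₐ[k] A₂ ⊗[k] B) hp
  rw [map_zero] at h
  rw [← h, aeval_def, aeval_def, eval₂_map]
  exact (hom_eval₂ p (algebraMap (Algebra.adjoin k {f x}) A₂)
    (Algebra.TensorProduct.includeLeft : A₂ →ₐ[k] A₂ ⊗[k] B).toRingHom a).symm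

lemma FixesLeft.nonempty_algEquiv [Nontrivial B] (h₁ : FixesLeft k A₁ B) (h₂ : FixesLeft k A₂ B)
    (hB : AK k B = ⊥) (σ : A₁ ⊗[k] B ≃ₐ[k] A₂ ⊗[k] B) : Nonempty (A₁ ≃ₐ[k] A₂) := by
  have hinj₁ : Function.Injective (Algebra.TensorProduct.includeLeft : A₁ →ₐ[k] A₁ ⊗[k] B) :=
    Algebra.TensorProduct.includeLeft_injective (algebraMap k B).injective
  have hinj₂ : Function.Injective (Algebra.TensorProduct.includeLeft : A₂ →ₐ[k] A₂ ⊗[k] B) :=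
    Algebra.TensorProduct.includeLeft_injective (algebraMap k B).injective
  obtain ⟨f, hf⟩ := h₁.exists_algHom hB σ
  obtain ⟨g, hg⟩ := h₂.exists_algHom hB σ.symm
  refine ⟨AlgEquiv.ofAlgHom f g (AlgHom.ext fun a => hinj₂ ?_) (AlgHom.ext fun a => hinj₁ ?_)⟩
  · simp [← hf, ← hg]
  · simp [← hf, ← hg]

end FixesLeft

/-- **Corollary.** Cancellation for curves against any domain `B` with `AK(B) = k`. -/
theorem cancellation_of_curves
    {k A₁ A₂ B : Type*} [Field k] [IsAlgClosed k]
    [CommRing A₁] [IsDomain A₁] [Algebra k A₁] [Algebra.FiniteType k A₁]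
    [CommRing A₂] [IsDomain A₂] [Algebra k A₂] [Algebra.FiniteType k A₂]
    (htr₁ : TrdegOne k A₁) (htr₂ : TrdegOne k A₂)
    [CommRing B] [IsDomain B] [Algebra k B] (hB : AK k B = ⊥)
    (h : Nonempty ((A₁ ⊗[k] B) ≃ₐ[k] (A₂ ⊗[k] B))) :
    Nonempty (A₁ ≃ₐ[k] A₂) := by
  obtain ⟨σ⟩ := h
  by_cases h₁ : FixesLeft k A₁ B
  · exact h₁.nonempty_algEquiv (h₁.congr hB σ htr₁ htr₂) hB σ
  have h₂ : ¬ FixesLeft k A₂ B := fun h₂ => h₁ (h₂.congr hB σ.symm htr₂ htr₁)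
  simp only [FixesLeft, not_forall] at h₁ h₂
  obtain ⟨φ₁, hφ₁, a₁, ha₁⟩ := h₁
  obtain ⟨φ₂, hφ₂, a₂, ha₂⟩ := h₂
  obtain ⟨e₁⟩ := nonempty_algEquiv_polynomial_of_exponential_ne htr₁ hφ₁ ha₁
  obtain ⟨e₂⟩ := nonempty_algEquiv_polynomial_of_exponential_ne htr₂ hφ₂ ha₂
  exact ⟨e₁.symm.trans e₂⟩
end

section
/- Let k be an algebraically closed field, let A be an affine domain over k with trdeg_k(A) = 1, and let B be an integral domain that is a k-algebra. Suppose there exists an exponential map φ on A ⊗_k B such that the image of A in A ⊗_k B is not contained in (A ⊗_k B)^φ. Then there exists an injective k-algebra homomorphism from A into the polynomial ring k[x]. -/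
open Polynomial TensorProduct

/-- An algebra of finite type over an algebraically closed field has a rational point at which a
given non-nilpotent element does not vanish. -/
theorem exists_algHom_apply_ne_zero {k S : Type*} [Field k] [IsAlgClosed k] [CommRing S]
    [Algebra k S] [Algebra.FiniteType k S] {c : S} (hc : ¬ IsNilpotent c) :
    ∃ g : S →ₐ[k] k, g c ≠ 0 := by
  have hnt : Nontrivial (Localization.Away c) := by
    by_contra hn
    rw [not_nontrivial_iff_subsingleton] at hn
    obtain ⟨n, hn⟩ := (IsLocalization.subsingleton_iff (S := Localization.Away c)
      (M := Submonoid.powers c)).1 hn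
    exact hc ⟨n, hn⟩
  obtain ⟨m, hm⟩ := Ideal.exists_maximal (Localization.Away c)
  let := Ideal.Quotient.field m
  have := finite_of_finite_type_of_isJacobsonRing k (Localization.Away c ⧸ m)
  let e : k ≃ₐ[k] Localization.Away c ⧸ m := AlgEquiv.ofBijective (Algebra.ofId k _)
    IsAlgClosed.algebraMap_bijective_of_isIntegral
  let q : S →ₐ[k] Localization.Away c ⧸ m :=
    (Ideal.Quotient.mkₐ k m).comp (IsScalarTower.toAlgHom k S (Localization.Away c))
  have hq : IsUnit (q c) :=
    (IsLocalization.Away.algebraMap_isUnit (S := Localization.Away c) c).map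
      (Ideal.Quotient.mkₐ k m)
  refine ⟨(e.symm : _ →ₐ[k] k).comp q, ?_⟩
  simpa using hq.ne_zero

/-- Over an algebraically closed field, the tensor product of a reduced algebra of finite type with
a reduced algebra is reduced. -/
theorem isReduced_tensorProduct_of_isAlgClosed {k A B : Type*} [Field k] [IsAlgClosed k]
    [CommRing A] [IsReduced A] [Algebra k A] [Algebra.FiniteType k A]
    [CommRing B] [IsReduced B] [Algebra k B] : IsReduced (A ⊗[k] B) := by
  refine ⟨fun c hc ↦ by_contra fun hne ↦ ?_⟩
  let b := Module.Basis.ofVectorSpace k B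
  obtain ⟨i, hi⟩ : ∃ i, (Algebra.TensorProduct.basis A b).repr c i ≠ 0 := by
    by_contra! h
    exact hne ((Algebra.TensorProduct.basis A b).repr.map_eq_zero_iff.1 (Finsupp.ext h))
  obtain ⟨g, hg⟩ := exists_algHom_apply_ne_zero (k := k)
    (c := (Algebra.TensorProduct.basis A b).repr c i) (by rwa [isNilpotent_iff_eq_zero])
  let p : A ⊗[k] B →ₐ[k] B :=
    Algebra.TensorProduct.lift ((Algebra.ofId k B).comp g) (AlgHom.id k B)
      (fun _ _ ↦ Commute.all _ _)
  have key (z : A ⊗[k] B) : b.repr (p z) i = g ((Algebra.TensorProduct.basis A b).repr z i) := by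
    induction z with
    | zero => simp
    | add x y hx hy => simp [hx, hy]
    | tmul x y => simp [p, Algebra.ofId_apply, ← Algebra.smul_def]
  have hp : p c = 0 := (hc.map p).eq_zero
  exact hg (by rw [← key, hp, map_zero, Finsupp.zero_apply])

/-- An algebra homomorphism from an algebra of finite type to a polynomial ring has coefficients in
a subalgebra of finite type. -/
theorem exists_fg_mapAlgHom_comp_eq {k A R : Type*} [Field k] [CommRing A] [Algebra k A]
    [Algebra.FiniteType k A] [CommRing R] [Algebra k R] (φ : A →ₐ[k] R[X]) :
    ∃ (S : Subalgebra k R) (_ : S.FG) (ψ : A →ₐ[k] S[X]), (mapAlgHom S.val).comp ψ = φ := by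
  classical
  obtain ⟨s, hs⟩ := Algebra.FiniteType.out (R := k) (A := A)
  let S : Subalgebra k R := Algebra.adjoin k (s.biUnion fun a ↦ (φ a).coeffs : Finset R)
  have hle (a : A) : φ a ∈ (mapAlgHom S.val).range := by
    suffices h : Algebra.adjoin k (s : Set A) ≤ (mapAlgHom S.val).range.comap φ from
      h (hs ▸ Algebra.mem_top)
    refine Algebra.adjoin_le fun x hx ↦ ?_
    have hx' : φ x ∈ (mapRingHom (S.val : S →+* R)).range := by
      refine (mem_map_range _).2 fun n ↦ ?_
      by_cases hn : (φ x).coeff n = 0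
      · exact hn ▸ zero_mem _
      · exact ⟨⟨_, Algebra.subset_adjoin (Finset.mem_coe.2 (Finset.mem_biUnion.2
          ⟨x, hx, coeff_mem_coeffs hn⟩))⟩, rfl⟩
    exact hx'
  have hinj : Function.Injective (mapAlgHom S.val) := map_injective _ Subtype.val_injective
  refine ⟨S, ⟨_, rfl⟩, ((AlgEquiv.ofInjective _ hinj).symm : _ →ₐ[k] S[X]).comp
    (φ.codRestrict _ hle), AlgHom.ext fun a ↦ ?_⟩
  exact congrArg Subtype.val ((AlgEquiv.ofInjective _ hinj).apply_symm_apply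
    (φ.codRestrict _ hle a))

/-- A homomorphism out of a domain of transcendence degree one is injective if its image contains a
transcendental element. -/
theorem TrdegOne.injective_of_transcendental {k A C : Type*} [Field k] [CommRing A] [IsDomain A]
    [Algebra k A] [CommRing C] [Algebra k C] (htr : TrdegOne k A) (f : A →ₐ[k] C) {a : A}
    (ha : Transcendental k (f a)) : Function.Injective f := by
  obtain ⟨x, hx⟩ := htr
  have hind : AlgebraicIndependent k (fun _ : Unit ↦ a) :=
    algebraicIndependent_unique_type_iff.2 fun h ↦ ha (h.algHom f)
  have hbasis : IsTranscendenceBasis k (fun _ : Unit ↦ a) := by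
    refine hind.isTranscendenceBasis_of_lift_trdeg_le_of_finite ?_
    rw [← hx.lift_cardinalMk_eq_trdeg]
  have halg := hbasis.isAlgebraic
  refine (injective_iff_map_eq_zero f).2 fun y hy ↦ by_contra fun hne ↦ ?_
  obtain ⟨⟨r, hr⟩, hr0, z, hz⟩ :=
    (halg.isAlgebraic y).exists_nonzero_dvd (mem_nonZeroDivisors_of_ne_zero hne)
  rw [Set.range_const, Algebra.adjoin_singleton_eq_range_aeval] at hr
  obtain ⟨q, rfl⟩ := hr
  have hq : aeval (f a) q = 0 := by
    rw [aeval_algHom_apply]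
    exact (congrArg f hz).trans (by rw [map_mul, hy, zero_mul])
  refine hr0 (Subtype.ext ?_)
  simp [transcendental_iff.1 ha q hq]

/-- **Lemma 5.** If some exponential map on `A ⊗ₖ B` does not fix the image of `A`,
then `A` embeds into the polynomial ring `k[x]`. -/
theorem embeds_into_polynomial_ring
    {k A B : Type*} [Field k] [IsAlgClosed k]
    [CommRing A] [IsDomain A] [Algebra k A] [Algebra.FiniteType k A]
    (htr : TrdegOne k A)
    [CommRing B] [IsDomain B] [Algebra k B]
    (φ : (A ⊗[k] B) →ₐ[k] (A ⊗[k] B)[X]) (hφ : IsExponential φ)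
    (h : ¬ (Algebra.TensorProduct.includeLeft : A →ₐ[k] A ⊗[k] B).range ≤
      expInvariants φ) :
    ∃ f : A →ₐ[k] Polynomial k, Function.Injective f := by
  obtain ⟨a, n, hn, hcoeff⟩ : ∃ (a : A) (n : ℕ), n ≠ 0 ∧ (φ (a ⊗ₜ 1)).coeff n ≠ 0 := by
    by_contra! H
    refine h ?_
    rintro _ ⟨a, rfl⟩
    refine Polynomial.ext fun n ↦ ?_
    change (φ (a ⊗ₜ 1)).coeff n = (C (a ⊗ₜ[k] (1 : B))).coeff n
    rcases eq_or_ne n 0 with rfl | hn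
    · rw [coeff_C_zero, coeff_zero_eq_eval_zero, hφ.1]
    · rw [coeff_C_of_ne_zero hn, H a n hn]
  have hred : IsReduced (A ⊗[k] B) := isReduced_tensorProduct_of_isAlgClosed
  obtain ⟨S, hS, ψ, hψ⟩ :=
    exists_fg_mapAlgHom_comp_eq (φ.comp Algebra.TensorProduct.includeLeft)
  have hfin : Algebra.FiniteType k S := S.fg_iff_finiteType.1 hS
  have hval : S.val ((ψ a).coeff n) = (φ (a ⊗ₜ 1)).coeff n := by
    have := congrArg (fun p ↦ p.coeff n) (DFunLike.congr_fun hψ a)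
    simpa using this
  obtain ⟨g, hg⟩ := exists_algHom_apply_ne_zero (k := k) (c := (ψ a).coeff n) fun hnil ↦
    hcoeff (hval ▸ (hnil.map S.val).eq_zero)
  refine ⟨(mapAlgHom g).comp ψ, htr.injective_of_transcendental _ (a := a) ?_⟩
  have hne : (((mapAlgHom g).comp ψ) a).coeff n ≠ 0 := by simpa using hg
  refine Polynomial.transcendental _ (fun h0 ↦ hn ?_) (mem_nonZeroDivisors_of_ne_zero ?_)
  · exact Nat.le_zero.1 (h0 ▸ le_natDegree_of_ne_zero hne)
  · exact leadingCoeff_ne_zero.2 fun h0 ↦ hne (by rw [h0, coeff_zero])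
end
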